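/- arXiv:1803.04233 — 2 statements merged into one kernel-verified Lean document; each statement's English description precedes it below -/
import Mathlib

section
/- Let d ≥ 1, V : ℝ^d → ℝ smooth, and f ∈ C_c^∞(ℝ^d). Then the integrated Bochner identity (the boundaryless case of Theorem 2.1) holds: ∫_{ℝ^d} (Lf)² dμ = ∫_{ℝ^d} ( ‖Hess_f‖²_HS − Hess_V(∇f, ∇f) ) dμ. -/
open MeasureTheory Real

/-- Partial derivative `∂ᵢ f` on `ℝ^n = Fin n → ℝ`. -/
noncomputable def pd {n : ℕ} (i : Fin n) (f : (Fin n → ℝ) → ℝ) (x : Fin n → ℝ) : ℝ :=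
  fderiv ℝ f x (Pi.single i 1)

/-- Hessian entry `∂ᵢ∂ⱼ f`. -/
noncomputable def hess {n : ℕ} (i j : Fin n) (f : (Fin n → ℝ) → ℝ) (x : Fin n → ℝ) : ℝ :=
  pd i (pd j f) x

/-- Euclidean Laplacian `Δf`. -/
noncomputable def lap {n : ℕ} (f : (Fin n → ℝ) → ℝ) (x : Fin n → ℝ) : ℝ :=
  ∑ i, hess i i f x

/-- Weighted Laplacian `L f = Δ f + ⟨∇V, ∇f⟩`. -/
noncomputable def Lop {n : ℕ} (V f : (Fin n → ℝ) → ℝ) (x : Fin n → ℝ) : ℝ :=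
  lap f x + ∑ i, pd i V x * pd i f x

/-- Squared Hilbert-Schmidt norm of the Hessian of `f`. -/
noncomputable def hessHS2 {n : ℕ} (f : (Fin n → ℝ) → ℝ) (x : Fin n → ℝ) : ℝ :=
  ∑ i, ∑ j, (hess i j f x) ^ 2

/-- The Hessian of `V` as a bilinear form evaluated at vectors `u, v`. -/
noncomputable def hessBil {n : ℕ} (V : (Fin n → ℝ) → ℝ) (x : Fin n → ℝ)
    (u v : Fin n → ℝ) : ℝ :=
  ∑ i, ∑ j, hess i j V x * u i * v j

/-- The gradient `∇f`. -/
noncomputable def grad {n : ℕ} (f : (Fin n → ℝ) → ℝ) (x : Fin n → ℝ) : Fin n → ℝ :=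
  fun i => pd i f x

section

variable {n : ℕ} {f g : (Fin n → ℝ) → ℝ}

lemma contDiff_pd (hf : ContDiff ℝ (⊤ : ℕ∞) f) (i : Fin n) : ContDiff ℝ (⊤ : ℕ∞) (pd i f) :=
  (hf.fderiv_right (m := (⊤ : ℕ∞)) (by simp)).clm_apply contDiff_const

lemma hasCompactSupport_pd (hf : HasCompactSupport f) (i : Fin n) :
    HasCompactSupport (pd i f) :=
  hf.fderiv_apply ℝ (Pi.single i 1)

lemma pd_comm (hf : ContDiff ℝ (⊤ : ℕ∞) f) (i j : Fin n) : pd i (pd j f) = pd j (pd i f) := by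
  have key (v w : Fin n → ℝ) (x : Fin n → ℝ) :
      fderiv ℝ (fun y => fderiv ℝ f y v) x w = fderiv ℝ (fderiv ℝ f) x w v := by
    have hd : DifferentiableAt ℝ (fderiv ℝ f) x :=
      ((hf.fderiv_right (m := (⊤ : ℕ∞)) (by simp)).differentiable (by simp)) x
    rw [fderiv_clm_apply hd (differentiableAt_const v)]
    simp
  funext x
  have hsymm : IsSymmSndFDerivAt ℝ f x :=
    hf.contDiffAt.isSymmSndFDerivAt
      (by simpa using WithTop.coe_le_coe.2 (le_top (a := (2 : ℕ∞))))
  change fderiv ℝ (fun y => fderiv ℝ f y _) x _ = fderiv ℝ (fun y => fderiv ℝ f y _) x _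
  rw [key, key]
  exact hsymm _ _

lemma pd_mul (hf : ContDiff ℝ (⊤ : ℕ∞) f) (hg : ContDiff ℝ (⊤ : ℕ∞) g) (i : Fin n)
    (x : Fin n → ℝ) :
    pd i (fun y => f y * g y) x = pd i f x * g x + f x * pd i g x := by
  unfold pd
  rw [fderiv_fun_mul (hf.differentiable (by simp) x) (hg.differentiable (by simp) x)]
  simp only [add_apply, smul_apply, smul_eq_mul]
  ring

lemma pd_add (hf : ContDiff ℝ (⊤ : ℕ∞) f) (hg : ContDiff ℝ (⊤ : ℕ∞) g) (i : Fin n)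
    (x : Fin n → ℝ) :
    pd i (fun y => f y + g y) x = pd i f x + pd i g x := by
  unfold pd
  rw [fderiv_fun_add (hf.differentiable (by simp) x) (hg.differentiable (by simp) x)]
  rfl

lemma pd_exp (hf : ContDiff ℝ (⊤ : ℕ∞) f) (i : Fin n) (x : Fin n → ℝ) :
    pd i (fun y => exp (f y)) x = exp (f x) * pd i f x := by
  unfold pd
  rw [fderiv_exp (hf.differentiable (by simp) x)]
  rfl

lemma integral_pd_eq_zero (hf : ContDiff ℝ (⊤ : ℕ∞) f) (hfc : HasCompactSupport f)
    (i : Fin n) : ∫ x, pd i f x = 0 := by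
  have hint : Integrable f := hf.continuous.integrable_of_hasCompactSupport hfc
  have hint' : Integrable (pd i f) :=
    (contDiff_pd hf i).continuous.integrable_of_hasCompactSupport (hasCompactSupport_pd hfc i)
  have h := integral_mul_fderiv_eq_neg_fderiv_mul_of_integrable (μ := volume)
    (f := fun _ : Fin n → ℝ => (1 : ℝ)) (g := f) (v := Pi.single i 1) (by simp)
    (by simpa [pd] using! hint') (by simpa using hint) (fun _ _ => differentiableAt_const _)
    (fun x _ => hf.differentiable (by simp) x)
  simpa [pd] using h

/-- The integrated Bochner identity for a single pair of coordinates. -/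
lemma integral_bochner_pair {V : (Fin n → ℝ) → ℝ} (hV : ContDiff ℝ (⊤ : ℕ∞) V)
    (hf : ContDiff ℝ (⊤ : ℕ∞) f) (hfc : HasCompactSupport f) (i j : Fin n) :
    ∫ x, (hess i i f x + pd i V x * pd i f x) * (hess j j f x + pd j V x * pd j f x) * exp (V x)
      = ∫ x, ((hess i j f x) ^ 2 - hess i j V x * pd i f x * pd j f x) * exp (V x) := by
  have hfi := contDiff_pd hf i
  have hfj := contDiff_pd hf j
  have hVj := contDiff_pd hV j
  have hfjj := contDiff_pd hfj j
  have hfij := contDiff_pd hfj i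
  have hVij := contDiff_pd hVj i
  have hE : ContDiff ℝ (⊤ : ℕ∞) (fun x => exp (V x)) := hV.exp
  have hci := hasCompactSupport_pd hfc i
  have hVf : ContDiff ℝ (⊤ : ℕ∞) (fun x => pd j V x * pd j f x) := hVj.mul hfj
  have hA : ContDiff ℝ (⊤ : ℕ∞) (fun x => pd j (pd j f) x + pd j V x * pd j f x) :=
    hfjj.add hVf
  have hAE : ContDiff ℝ (⊤ : ℕ∞)
      (fun x => (pd j (pd j f) x + pd j V x * pd j f x) * exp (V x)) := hA.mul hE
  have hBE : ContDiff ℝ (⊤ : ℕ∞) (fun x => pd i (pd j f) x * exp (V x)) := hfij.mul hE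
  have hF : ContDiff ℝ (⊤ : ℕ∞) (fun x => pd i f x *
      ((pd j (pd j f) x + pd j V x * pd j f x) * exp (V x))) := hfi.mul hAE
  have hG : ContDiff ℝ (⊤ : ℕ∞) (fun x => pd i f x * (pd i (pd j f) x * exp (V x))) :=
    hfi.mul hBE
  have hFc : HasCompactSupport (fun x => pd i f x *
      ((pd j (pd j f) x + pd j V x * pd j f x) * exp (V x))) := hci.mul_right
  have hGc : HasCompactSupport (fun x => pd i f x * (pd i (pd j f) x * exp (V x))) :=
    hci.mul_right
  have hF0 := integral_pd_eq_zero hF hFc i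
  have hG0 := integral_pd_eq_zero hG hGc j
  have hFint : Integrable (pd i (fun x => pd i f x *
      ((pd j (pd j f) x + pd j V x * pd j f x) * exp (V x)))) :=
    (contDiff_pd hF i).continuous.integrable_of_hasCompactSupport (hasCompactSupport_pd hFc i)
  have hGint : Integrable (pd j (fun x => pd i f x * (pd i (pd j f) x * exp (V x)))) :=
    (contDiff_pd hG j).continuous.integrable_of_hasCompactSupport (hasCompactSupport_pd hGc j)
  have hR : Integrable
      (fun x => ((hess i j f x) ^ 2 - hess i j V x * pd i f x * pd j f x) * exp (V x)) := by
    refine Continuous.integrable_of_hasCompactSupport ?_ ?_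
    · exact (((hfij.pow 2).sub ((hVij.mul hfi).mul hfj)).mul hE).continuous
    · refine HasCompactSupport.mul_right (HasCompactSupport.sub ?_ ?_)
      · exact (hasCompactSupport_pd (hasCompactSupport_pd hfc j) i).comp_left
          (g := fun t : ℝ => t ^ 2) (by simp)
      · exact (hasCompactSupport_pd hfc j).mul_left
  have hpt (x : Fin n → ℝ) :
      (hess i i f x + pd i V x * pd i f x) * (hess j j f x + pd j V x * pd j f x) * exp (V x)
      = ((hess i j f x) ^ 2 - hess i j V x * pd i f x * pd j f x) * exp (V x)
        + (pd i (fun x => pd i f x *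
            ((pd j (pd j f) x + pd j V x * pd j f x) * exp (V x))) x
          - pd j (fun x => pd i f x * (pd i (pd j f) x * exp (V x))) x) := by
    rw [pd_mul hfi hAE, pd_mul hA hE, pd_add hfjj hVf, pd_mul hVj hfj, pd_exp hV,
      pd_mul hfi hBE, pd_mul hfij hE, pd_exp hV, pd_comm hfj j i, pd_comm hf j i]
    simp only [hess]
    ring
  simp_rw [hpt]
  refine (integral_add hR (hFint.sub hGint)).trans ?_
  rw [integral_sub' hFint hGint, hF0, hG0]
  simp

end

/-- the integrated Bochner identity on `ℝ^d` (boundaryless case):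
`∫ (Lf)² dμ = ∫ ( ‖Hess_f‖²_HS − Hess_V(∇f,∇f) ) dμ` for `f ∈ C_c^∞(ℝ^d)`,
where `μ = e^V dx`. -/
theorem integrated_bochner_identity
    (d : ℕ) (hd : 1 ≤ d) (V f : (Fin d → ℝ) → ℝ)
    (hV : ContDiff ℝ (⊤ : ℕ∞) V) (hf : ContDiff ℝ (⊤ : ℕ∞) f) (hfc : HasCompactSupport f) :
    ∫ x, (Lop V f x) ^ 2 * exp (V x)
      = ∫ x, (hessHS2 f x - hessBil V x (grad f x) (grad f x)) * exp (V x) := by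
  have hterm (g h : (Fin d → ℝ) → ℝ) (hg : ContDiff ℝ (⊤ : ℕ∞) g)
      (hh : ContDiff ℝ (⊤ : ℕ∞) h) (hgc : HasCompactSupport g) :
      Integrable (fun x => g x * h x) :=
    (hg.mul hh).continuous.integrable_of_hasCompactSupport hgc.mul_right
  have hA (i : Fin d) :
      ContDiff ℝ (⊤ : ℕ∞) (fun x => hess i i f x + pd i V x * pd i f x) :=
    (contDiff_pd (contDiff_pd hf i) i).add ((contDiff_pd hV i).mul (contDiff_pd hf i))
  have hAc (i : Fin d) : HasCompactSupport (fun x => hess i i f x + pd i V x * pd i f x) :=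
    (hasCompactSupport_pd (hasCompactSupport_pd hfc i) i).add
      (hasCompactSupport_pd hfc i).mul_left
  have hE : ContDiff ℝ (⊤ : ℕ∞) (fun x => exp (V x)) := hV.exp
  have hleft (x : Fin d → ℝ) : (Lop V f x) ^ 2 * exp (V x) =
      ∑ i, ∑ j, (hess i i f x + pd i V x * pd i f x) *
        (hess j j f x + pd j V x * pd j f x) * exp (V x) := by
    simp only [Lop, lap]
    rw [← Finset.sum_add_distrib, sq, Finset.sum_mul_sum]
    simp_rw [Finset.sum_mul]
  have hright (x : Fin d → ℝ) :
      (hessHS2 f x - hessBil V x (grad f x) (grad f x)) * exp (V x) =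
      ∑ i, ∑ j, ((hess i j f x) ^ 2 - hess i j V x * pd i f x * pd j f x) * exp (V x) := by
    simp only [hessHS2, hessBil, grad]
    simp_rw [← Finset.sum_sub_distrib, Finset.sum_mul]
  have hL (i j : Fin d) : Integrable (fun x => (hess i i f x + pd i V x * pd i f x) *
      (hess j j f x + pd j V x * pd j f x) * exp (V x)) :=
    hterm _ _ ((hA i).mul (hA j)) hE (hAc i).mul_right
  have hR (i j : Fin d) : Integrable
      (fun x => ((hess i j f x) ^ 2 - hess i j V x * pd i f x * pd j f x) * exp (V x)) := by
    refine hterm (fun x => (hess i j f x) ^ 2 - hess i j V x * pd i f x * pd j f x) _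
      (((contDiff_pd (contDiff_pd hf j) i).pow 2).sub
      (((contDiff_pd (contDiff_pd hV j) i).mul (contDiff_pd hf i)).mul (contDiff_pd hf j))) hE
      (HasCompactSupport.sub ?_ (hasCompactSupport_pd hfc j).mul_left)
    exact (hasCompactSupport_pd (hasCompactSupport_pd hfc j) i).comp_left
      (g := fun t : ℝ => t ^ 2) (by simp)
  simp_rw [hleft, hright]
  rw [integral_finsetSum _ fun i _ => integrable_finsetSum _ fun j _ => hL i j,
    integral_finsetSum _ fun i _ => integrable_finsetSum _ fun j _ => hR i j]
  refine Finset.sum_congr rfl fun i _ => ?_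
  rw [integral_finsetSum _ fun j _ => hL i j, integral_finsetSum _ fun j _ => hR i j]
  exact Finset.sum_congr rfl fun j _ => integral_bochner_pair hV hf hfc i j
end

section
/- (Half-space case of Lemma 2.3(1).) Let d ≥ 2, let q : H → Sym_d(ℝ) and q_∂ : ℝ^{d−1} → Sym_{d−1}(ℝ) be continuous. Suppose that for every f ∈ C_c^∞(ℝ^d) with ∂_d f(x̂, 0) = 0 for all x̂ one has ∫_H ⟨q(x) ∇f(x), ∇f(x)⟩ dx + ∫_{ℝ^{d−1}} ⟨q_∂(x̂) ∇̂f(x̂,0), ∇̂f(x̂,0)⟩ dx̂ ≥ 0, where ∇̂f = (∂_1 f, …, ∂_{d−1} f) is the tangential gradient. Then q(x) is positive semidefinite for every x ∈ H and q_∂(x̂) is positive semidefinite for every x̂ ∈ ℝ^{d−1}. -/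
open MeasureTheory Real

/-- The closed upper half-space `H = {x ∈ ℝ^{d+1} : x_{d+1} ≥ 0}`. -/
def upperHalf (d : ℕ) : Set (Fin (d + 1) → ℝ) := {x | 0 ≤ x (Fin.last d)}

open Filter Topology

section QuadraticForm

variable {X ι : Type*} [TopologicalSpace X] [Fintype ι]

lemma continuousOn_sum_sum_mul {A : X → Matrix ι ι ℝ} {S : Set X} (hA : ContinuousOn A S)
    {g : ι → X → ℝ} (hg : ∀ i, Continuous (g i)) :
    ContinuousOn (fun x => ∑ i, ∑ j, A x i j * g i x * g j x) S := by
  refine continuousOn_finsetSum _ fun i _ => continuousOn_finsetSum _ fun j _ => ?_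
  exact (((continuous_id.matrix_elem i j).comp_continuousOn hA).mul
    (hg i).continuousOn).mul (hg j).continuousOn

lemma integrableOn_sum_sum_mul [MeasurableSpace X] [T2Space X] [OpensMeasurableSpace X]
    {μ : Measure X} [IsFiniteMeasureOnCompacts μ] {A : X → Matrix ι ι ℝ} {S K : Set X}
    (hS : IsClosed S) (hK : IsCompact K) (hA : ContinuousOn A S)
    {g : ι → X → ℝ} (hg : ∀ i, Continuous (g i)) (h0 : ∀ i, ∀ x ∉ K, g i x = 0) :
    IntegrableOn (fun x => ∑ i, ∑ j, A x i j * g i x * g j x) S μ := by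
  have hcomp : IsCompact (S ∩ K) := hK.inter_left hS
  have h1 : IntegrableOn (fun x => ∑ i, ∑ j, A x i j * g i x * g j x) (S ∩ K) μ :=
    ((continuousOn_sum_sum_mul hA hg).mono Set.inter_subset_left).integrableOn_compact' hcomp
      hcomp.measurableSet
  refine h1.of_forall_sdiff_eq_zero hS.measurableSet fun x hx => ?_
  have hxK : x ∉ K := fun h => hx.2 ⟨hx.1, h⟩
  simp [h0 _ x hxK]

end QuadraticForm

section PartialDerivative

variable {n : ℕ}

lemma continuous_pd {f : (Fin n → ℝ) → ℝ} (hf : ContDiff ℝ (⊤ : ℕ∞) f) (i : Fin n) :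
    Continuous (pd i f) :=
  (hf.continuous_fderiv (by simp)).clm_apply continuous_const

lemma pd_eq_zero_of_notMem_tsupport {f : (Fin n → ℝ) → ℝ} {x : Fin n → ℝ}
    (hx : x ∉ tsupport f) (i : Fin n) : pd i f x = 0 := by
  simp [pd, fderiv_of_notMem_tsupport ℝ hx]

lemma pd_mul_cos {f : (Fin n → ℝ) → ℝ} {x : Fin n → ℝ} (hf : DifferentiableAt ℝ f x)
    (l : (Fin n → ℝ) →L[ℝ] ℝ) (i : Fin n) :
    pd i (fun y => f y * cos (l y)) x
      = cos (l x) * pd i f x - sin (l x) * (f x * l (Pi.single i 1)) := by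
  have h := hf.hasFDerivAt.mul (l.hasFDerivAt (x := x)).cos
  simp only [pd]
  rw [HasFDerivAt.fderiv (f := fun y => f y * cos (l y)) h]
  simp
  ring

lemma pd_mul_sin {f : (Fin n → ℝ) → ℝ} {x : Fin n → ℝ} (hf : DifferentiableAt ℝ f x)
    (l : (Fin n → ℝ) →L[ℝ] ℝ) (i : Fin n) :
    pd i (fun y => f y * sin (l y)) x
      = sin (l x) * pd i f x + cos (l x) * (f x * l (Pi.single i 1)) := by
  have h := hf.hasFDerivAt.mul (l.hasFDerivAt (x := x)).sin
  simp only [pd]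
  rw [HasFDerivAt.fderiv (f := fun y => f y * sin (l y)) h]
  simp
  ring

end PartialDerivative

lemma sum_sum_mul_rotate {ι : Type*} [Fintype ι] (A : Matrix ι ι ℝ) (a b : ι → ℝ) (θ t : ℝ) :
    (∑ i, ∑ j, A i j * (cos θ * a i - sin θ * (t * b i)) * (cos θ * a j - sin θ * (t * b j)))
      + (∑ i, ∑ j, A i j * (sin θ * a i + cos θ * (t * b i)) * (sin θ * a j + cos θ * (t * b j)))
      = (∑ i, ∑ j, A i j * a i * a j) + t ^ 2 * ∑ i, ∑ j, A i j * b i * b j := by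
  simp only [Finset.mul_sum, ← Finset.sum_add_distrib]
  refine Finset.sum_congr rfl fun i _ => Finset.sum_congr rfl fun j _ => ?_
  linear_combination (A i j * a i * a j + t ^ 2 * (A i j * b i * b j)) * Real.sin_sq_add_cos_sq θ

lemma isClosed_upperHalf (d : ℕ) : IsClosed (upperHalf d) :=
  isClosed_le continuous_const (continuous_apply _)

lemma continuous_snoc_zero (d : ℕ) :
    Continuous (fun xb : Fin d → ℝ => (Fin.snoc xb 0 : Fin (d + 1) → ℝ)) := by
  fun_prop

lemma nonneg_of_forall_nonneg_add_sq_mul {a b : ℝ} (h : ∀ t : ℝ, 0 ≤ a + t ^ 2 * b) : 0 ≤ b := by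
  by_contra! hb
  have h1 := h (√((|a| + 1) / (-b)))
  rw [Real.sq_sqrt (div_nonneg (by positivity) (by linarith))] at h1
  have h2 : (|a| + 1) / (-b) * b = -(|a| + 1) := by
    field_simp [hb.ne]
  linarith [le_abs_self a]

/-- Testing against `φ cos (t v·x)` and `φ sin (t v·x)` and letting `t → ∞` yields nonnegativity of
the leading coefficient. -/
lemma nonneg_of_oscillating_test (d : ℕ)
    (q : (Fin (d + 1) → ℝ) → Matrix (Fin (d + 1)) (Fin (d + 1)) ℝ)
    (qb : (Fin d → ℝ) → Matrix (Fin d) (Fin d) ℝ)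
    (hqc : ContinuousOn q (upperHalf d)) (hqbc : Continuous qb)
    (hpos : ∀ f : (Fin (d + 1) → ℝ) → ℝ, ContDiff ℝ (⊤ : ℕ∞) f → HasCompactSupport f →
      (∀ xb : Fin d → ℝ, pd (Fin.last d) f (Fin.snoc xb 0) = 0) →
      0 ≤ (∫ x in upperHalf d, ∑ i, ∑ j, q x i j * pd i f x * pd j f x)
          + ∫ xb : Fin d → ℝ, ∑ i, ∑ j,
              qb xb i j * pd (Fin.castSucc i) f (Fin.snoc xb 0)
                * pd (Fin.castSucc j) f (Fin.snoc xb 0))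
    {φ : (Fin (d + 1) → ℝ) → ℝ} (hφ : ContDiff ℝ (⊤ : ℕ∞) φ) (hφc : HasCompactSupport φ)
    (v : Fin (d + 1) → ℝ)
    (hN : ∀ xb : Fin d → ℝ, pd (Fin.last d) φ (Fin.snoc xb 0) = 0)
    (hv : ∀ xb : Fin d → ℝ, φ (Fin.snoc xb 0) * v (Fin.last d) = 0) :
    0 ≤ (∫ x in upperHalf d, ∑ i, ∑ j, q x i j * (φ x * v i) * (φ x * v j))
      + ∫ xb : Fin d → ℝ, ∑ i, ∑ j,
          qb xb i j * (φ (Fin.snoc xb 0) * v (Fin.castSucc i))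
            * (φ (Fin.snoc xb 0) * v (Fin.castSucc j)) := by
  set s : (Fin d → ℝ) → (Fin (d + 1) → ℝ) := fun xb => Fin.snoc xb 0 with hs
  have hsc : Continuous s := continuous_snoc_zero d
  set K := tsupport φ
  have hK : IsCompact K := hφc
  have hKb : IsCompact ((fun x : Fin (d + 1) → ℝ => (Fin.init x : Fin d → ℝ)) '' K) :=
    hK.image (by unfold Fin.init; fun_prop)
  set Kb := (fun x : Fin (d + 1) → ℝ => (Fin.init x : Fin d → ℝ)) '' K
  have hsK : ∀ xb ∉ Kb, s xb ∉ K := fun xb hxb h => hxb ⟨s xb, h, by simp [hs]⟩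
  have hIq : ∀ {g : Fin (d + 1) → (Fin (d + 1) → ℝ) → ℝ}, (∀ i, Continuous (g i)) →
      (∀ i, ∀ x ∉ K, g i x = 0) →
      IntegrableOn (fun x => ∑ i, ∑ j, q x i j * g i x * g j x) (upperHalf d) :=
    fun hg h0 => integrableOn_sum_sum_mul (isClosed_upperHalf d) hK hqc hg h0
  have hIb : ∀ {g : Fin (d + 1) → (Fin (d + 1) → ℝ) → ℝ}, (∀ i, Continuous (g i)) →
      (∀ i, ∀ x ∉ K, g i x = 0) →
      Integrable (fun xb => ∑ i : Fin d, ∑ j : Fin d,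
        qb xb i j * g i.castSucc (s xb) * g j.castSucc (s xb)) := by
    intro g hg h0
    rw [← integrableOn_univ]
    exact integrableOn_sum_sum_mul (g := fun i xb => g i.castSucc (s xb)) isClosed_univ hKb
      hqbc.continuousOn (fun i => (hg _).comp hsc) (fun i x hx => h0 _ _ (hsK x hx))
  have hφd : Differentiable ℝ φ := hφ.differentiable (by simp)
  have hφ0 : ∀ x ∉ K, φ x = 0 := fun x hx => image_eq_zero_of_notMem_tsupport hx
  have hgc : ∀ i, Continuous (pd i φ) := continuous_pd hφ
  have hg0 : ∀ i, ∀ x ∉ K, pd i φ x = 0 := fun i x hx => pd_eq_zero_of_notMem_tsupport hx i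
  have hwc : ∀ i, Continuous (fun x => φ x * v i) := fun i => hφ.continuous.mul continuous_const
  have hw0 : ∀ i, ∀ x ∉ K, φ x * v i = 0 := fun i x hx => by simp [hφ0 x hx]
  refine nonneg_of_forall_nonneg_add_sq_mul
    (a := (∫ x in upperHalf d, ∑ i, ∑ j, q x i j * pd i φ x * pd j φ x)
      + ∫ xb : Fin d → ℝ, ∑ i, ∑ j,
          qb xb i j * pd (Fin.castSucc i) φ (s xb) * pd (Fin.castSucc j) φ (s xb)) fun t => ?_
  let l : (Fin (d + 1) → ℝ) →L[ℝ] ℝ := ∑ i, (t * v i) • ContinuousLinearMap.proj i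
  have hl : ∀ i, l (Pi.single i 1) = t * v i := by
    intro i
    simp [l, Pi.single_apply]
  have hcos : ∀ i x, pd i (fun y => φ y * cos (l y)) x
      = cos (l x) * pd i φ x - sin (l x) * (t * (φ x * v i)) := by
    intro i x
    rw [pd_mul_cos (hφd x), hl]; ring
  have hsin : ∀ i x, pd i (fun y => φ y * sin (l y)) x
      = sin (l x) * pd i φ x + cos (l x) * (t * (φ x * v i)) := by
    intro i x
    rw [pd_mul_sin (hφd x), hl]; ring
  have h1 := hpos (fun y => φ y * cos (l y)) (hφ.mul l.contDiff.cos) hφc.mul_right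
    (fun xb => by rw [hcos, hN, hv]; simp)
  have h2 := hpos (fun y => φ y * sin (l y)) (hφ.mul l.contDiff.sin) hφc.mul_right
    (fun xb => by rw [hsin, hN, hv]; simp)
  simp only [hcos] at h1
  simp only [hsin] at h2
  have hcosc : ∀ i, Continuous fun x =>
      cos (l x) * pd i φ x - sin (l x) * (t * (φ x * v i)) := fun i =>
    ((continuous_cos.comp l.continuous).mul (hgc i)).sub ((continuous_sin.comp l.continuous).mul (continuous_const.mul (hwc i)))
  have hsinc : ∀ i, Continuous fun x =>
      sin (l x) * pd i φ x + cos (l x) * (t * (φ x * v i)) := fun i =>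
    ((continuous_sin.comp l.continuous).mul (hgc i)).add ((continuous_cos.comp l.continuous).mul (continuous_const.mul (hwc i)))
  have hcos0 : ∀ i, ∀ x ∉ K, cos (l x) * pd i φ x - sin (l x) * (t * (φ x * v i)) = 0 :=
    fun i x hx => by simp [hg0 i x hx, hφ0 x hx]
  have hsin0 : ∀ i, ∀ x ∉ K, sin (l x) * pd i φ x + cos (l x) * (t * (φ x * v i)) = 0 :=
    fun i x hx => by simp [hg0 i x hx, hφ0 x hx]
  have e1 := integral_add (hIq hcosc hcos0) (hIq hsinc hsin0)
  have e2 := integral_add (hIb hcosc hcos0) (hIb hsinc hsin0)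
  have e3 := integral_add (hIq hgc hg0) ((hIq hwc hw0).const_mul (t ^ 2))
  have e4 := integral_add (hIb hgc hg0) ((hIb hwc hw0).const_mul (t ^ 2))
  rw [integral_const_mul] at e3 e4
  simp only [sum_sum_mul_rotate] at e1
  simp only [sum_sum_mul_rotate _ (fun i => pd (Fin.castSucc i) φ (s _))
    (fun i => φ (s _) * v (Fin.castSucc i))] at e2
  linarith

lemma sum_sum_mul_scale {ι : Type*} [Fintype ι] (A : Matrix ι ι ℝ) (c : ℝ) (v : ι → ℝ) :
    (∑ i, ∑ j, A i j * (c * v i) * (c * v j)) = c ^ 2 * ∑ i, ∑ j, A i j * v i * v j := by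
  simp only [Finset.mul_sum]
  exact Finset.sum_congr rfl fun i _ => Finset.sum_congr rfl fun j _ => by ring

lemma posSemidef_of_sum_sum_nonneg {ι : Type*} [Fintype ι] {A : Matrix ι ι ℝ} (hA : A.IsSymm)
    (h : ∀ v : ι → ℝ, 0 ≤ ∑ i, ∑ j, A i j * v i * v j) : A.PosSemidef := by
  refine .of_dotProduct_mulVec_nonneg (by simpa [Matrix.IsHermitian] using hA.eq) fun v => ?_
  have : star v ⬝ᵥ A.mulVec v = ∑ i, ∑ j, A i j * v i * v j := by
    simp only [dotProduct, Matrix.mulVec, Finset.mul_sum, Pi.star_apply, star_trivial]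
    exact Finset.sum_congr rfl fun i _ => Finset.sum_congr rfl fun j _ => by ring
  exact this ▸ h v

lemma setIntegral_sq_mul_neg {X : Type*} [TopologicalSpace X] [MeasurableSpace X]
    [OpensMeasurableSpace X] {μ : Measure X} [IsFiniteMeasureOnCompacts μ] [μ.IsOpenPosMeasure]
    {S : Set X} (hS : MeasurableSet S) {φ B : X → ℝ} {c : ℝ} (hc : c < 0) (hφ : Continuous φ)
    (hφc : HasCompactSupport φ) {x₀ : X} (hx₀ : φ x₀ ≠ 0)
    (hsupp : ∀ x, φ x ≠ 0 → x ∈ S ∧ B x ≤ c)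
    (hint : IntegrableOn (fun x => φ x ^ 2 * B x) S μ) :
    ∫ x in S, φ x ^ 2 * B x ∂μ < 0 := by
  have hc2 : HasCompactSupport fun x => φ x ^ 2 := hφc.comp_left (g := fun y : ℝ => y ^ 2) (by simp)
  have hcont : Continuous fun x => φ x ^ 2 := hφ.pow 2
  have hi : Integrable (fun x => φ x ^ 2) μ := hcont.integrable_of_hasCompactSupport hc2
  have hpos : 0 < ∫ x, φ x ^ 2 ∂μ :=
    hcont.integral_pos_of_hasCompactSupport_nonneg_nonzero hc2 (fun x => sq_nonneg _)
      (pow_ne_zero 2 hx₀)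
  have hS' : ∫ x in S, φ x ^ 2 ∂μ = ∫ x, φ x ^ 2 ∂μ := by
    refine setIntegral_eq_integral_of_forall_compl_eq_zero fun x hx => ?_
    by_contra h
    exact hx (hsupp x fun h0 => h (by simp [h0])).1
  have hle : ∫ x in S, φ x ^ 2 * B x ∂μ ≤ ∫ x in S, φ x ^ 2 * c ∂μ := by
    refine setIntegral_mono_on hint (hi.mul_const c).integrableOn hS fun x _ => ?_
    by_cases h : φ x = 0
    · simp [h]
    · exact mul_le_mul_of_nonneg_left (hsupp x h).2 (sq_nonneg _)
  rw [integral_mul_const, hS'] at hle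
  nlinarith

lemma nonneg_of_pos_last (d : ℕ)
    (q : (Fin (d + 1) → ℝ) → Matrix (Fin (d + 1)) (Fin (d + 1)) ℝ)
    (qb : (Fin d → ℝ) → Matrix (Fin d) (Fin d) ℝ)
    (hqc : ContinuousOn q (upperHalf d)) (hqbc : Continuous qb)
    (hpos : ∀ f : (Fin (d + 1) → ℝ) → ℝ, ContDiff ℝ (⊤ : ℕ∞) f → HasCompactSupport f →
      (∀ xb : Fin d → ℝ, pd (Fin.last d) f (Fin.snoc xb 0) = 0) →
      0 ≤ (∫ x in upperHalf d, ∑ i, ∑ j, q x i j * pd i f x * pd j f x)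
          + ∫ xb : Fin d → ℝ, ∑ i, ∑ j,
              qb xb i j * pd (Fin.castSucc i) f (Fin.snoc xb 0)
                * pd (Fin.castSucc j) f (Fin.snoc xb 0))
    {x₀ : Fin (d + 1) → ℝ} (hx₀ : 0 < x₀ (Fin.last d)) (v : Fin (d + 1) → ℝ) :
    0 ≤ ∑ i, ∑ j, q x₀ i j * v i * v j := by
  by_contra! hneg
  have hpd : ∀ᶠ x : Fin (d + 1) → ℝ in 𝓝 x₀, 0 < x (Fin.last d) :=
    (continuous_apply (Fin.last d)).continuousAt.eventually (lt_mem_nhds hx₀)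
  have hHn : upperHalf d ∈ 𝓝 x₀ := hpd.mono fun x hx => le_of_lt hx
  have hB : ContinuousOn (fun x => ∑ i, ∑ j, q x i j * v i * v j) (upperHalf d) :=
    continuousOn_sum_sum_mul hqc (g := fun i _ => v i) fun _ => continuous_const
  set B := fun x => ∑ i, ∑ j, q x i j * v i * v j
  have hBn : B x₀ < 0 := hneg
  have hBev : ∀ᶠ x in 𝓝 x₀, B x < B x₀ / 2 :=
    (hB.continuousAt hHn).eventually (gt_mem_nhds (by linarith))
  obtain ⟨r, hr, hball⟩ := Metric.nhds_basis_closedBall.eventually_iff.1 (hpd.and hBev)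
  let φ : ContDiffBump x₀ := ⟨r / 2, r, by linarith, by linarith⟩
  have hφsupp : ∀ x, x (Fin.last d) ≤ 0 → x ∉ tsupport φ := fun x hx h => by
    rw [φ.tsupport_eq] at h
    exact absurd (hball h).1 (not_lt.2 hx)
  have hsub : ∀ x, φ x ≠ 0 → x ∈ upperHalf d ∧ B x ≤ B x₀ / 2 := fun x hx => by
    have h : x ∈ tsupport φ := subset_tsupport _ hx
    rw [φ.tsupport_eq] at h
    exact ⟨(hball h).1.le, (hball h).2.le⟩
  have hb0 : ∀ xb : Fin d → ℝ, φ (Fin.snoc xb 0 : Fin (d + 1) → ℝ) = 0 := fun xb =>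
    image_eq_zero_of_notMem_tsupport (hφsupp _ (by simp))
  have key := nonneg_of_oscillating_test d q qb hqc hqbc hpos φ.contDiff φ.hasCompactSupport v
    (fun xb => pd_eq_zero_of_notMem_tsupport (hφsupp _ (by simp)) _)
    (fun xb => by rw [hb0, zero_mul])
  have hint := integrableOn_sum_sum_mul (μ := volume) (isClosed_upperHalf d) φ.hasCompactSupport hqc
    (g := fun i x => φ x * v i) (fun i => φ.continuous.mul continuous_const)
    (fun i x hx => by rw [image_eq_zero_of_notMem_tsupport hx, zero_mul])
  simp only [sum_sum_mul_scale, hb0] at key hint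
  have hlt := setIntegral_sq_mul_neg (μ := volume) (isClosed_upperHalf d).measurableSet
    (show B x₀ / 2 < 0 by linarith) φ.continuous φ.hasCompactSupport (x₀ := x₀)
    (by simp [φ.one_of_mem_closedBall (Metric.mem_closedBall_self φ.rIn_pos.le)]) hsub hint
  simp at key
  linarith

lemma nonneg_of_mem_upperHalf {d : ℕ}
    {q : (Fin (d + 1) → ℝ) → Matrix (Fin (d + 1)) (Fin (d + 1)) ℝ}
    (hqc : ContinuousOn q (upperHalf d)) (v : Fin (d + 1) → ℝ)
    (h : ∀ x : Fin (d + 1) → ℝ, 0 < x (Fin.last d) → 0 ≤ ∑ i, ∑ j, q x i j * v i * v j)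
    {x : Fin (d + 1) → ℝ} (hx : x ∈ upperHalf d) : 0 ≤ ∑ i, ∑ j, q x i j * v i * v j := by
  have hB : ContinuousOn (fun x => ∑ i, ∑ j, q x i j * v i * v j) (upperHalf d) :=
    continuousOn_sum_sum_mul hqc (g := fun i _ => v i) fun _ => continuous_const
  have hx' : 0 ≤ x (Fin.last d) := hx
  let p : ℝ → Fin (d + 1) → ℝ := fun t => x + t • Pi.single (Fin.last d) 1
  have hp0 : p 0 = x := by simp [p]
  have hpl : ∀ t, p t (Fin.last d) = x (Fin.last d) + t := fun t => by simp [p]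
  have hpos : ∀ᶠ t in 𝓝[>] (0 : ℝ), 0 < p t (Fin.last d) :=
    eventually_mem_nhdsWithin.mono fun t ht => by rw [hpl]; exact add_pos_of_nonneg_of_pos hx' ht
  have hpc : Tendsto p (𝓝[>] 0) (𝓝[upperHalf d] x) := by
    refine tendsto_nhdsWithin_iff.2 ⟨?_, hpos.mono fun t ht => le_of_lt ht⟩
    have : Continuous p := by fun_prop
    exact hp0 ▸ (this.tendsto 0).mono_left nhdsWithin_le_nhds
  exact ge_of_tendsto ((hB x hx).tendsto.comp hpc) (hpos.mono fun t ht => h _ ht)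

/-- A product test function, depending on the last coordinate only through a cut-off. -/
noncomputable def collar {d : ℕ} (χ : ℝ → ℝ) (ψ : (Fin d → ℝ) → ℝ) (x : Fin (d + 1) → ℝ) : ℝ :=
  χ (x (Fin.last d)) * ψ (Fin.init x)

lemma contDiff_collar {d : ℕ} {χ : ℝ → ℝ} {ψ : (Fin d → ℝ) → ℝ} (hχ : ContDiff ℝ (⊤ : ℕ∞) χ)
    (hψ : ContDiff ℝ (⊤ : ℕ∞) ψ) : ContDiff ℝ (⊤ : ℕ∞) (collar χ ψ) :=
  (hχ.comp (contDiff_apply ℝ ℝ (Fin.last d))).mul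
    (hψ.comp (contDiff_pi.2 fun i => contDiff_apply ℝ ℝ (Fin.castSucc i)))

lemma pd_last_collar {d : ℕ} {χ : ℝ → ℝ} {ψ : (Fin d → ℝ) → ℝ} (hχ : ContDiff ℝ (⊤ : ℕ∞) χ)
    (hψ : ContDiff ℝ (⊤ : ℕ∞) ψ) (h1 : χ =ᶠ[𝓝 0] 1) (xb : Fin d → ℝ) :
    pd (Fin.last d) (collar χ ψ) (Fin.snoc xb 0) = 0 := by
  have hd := ((contDiff_collar hχ hψ).differentiable (by simp)) (Fin.snoc xb 0)
  rw [pd, ← hd.lineDeriv_eq_fderiv, lineDeriv]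
  have hsnoc : ∀ t : ℝ, (Fin.snoc xb 0 + t • Pi.single (Fin.last d) 1 : Fin (d + 1) → ℝ)
      = Fin.snoc xb t := fun t => by
    ext i
    refine Fin.lastCases ?_ (fun j => ?_) i <;> simp
  have : (fun t : ℝ => collar χ ψ (Fin.snoc xb 0 + t • Pi.single (Fin.last d) 1))
      =ᶠ[𝓝 0] fun _ => ψ xb := h1.mono fun t ht => by
    simp [hsnoc, collar, ht]
  rw [this.deriv_eq, deriv_const]

/-- The cylinder `{x : |x_d| ≤ 1, x̂ ∈ L}`. -/
def cylinder {d : ℕ} (L : Set (Fin d → ℝ)) : Set (Fin (d + 1) → ℝ) :=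
  (fun p : ℝ × (Fin d → ℝ) => (Fin.snoc p.2 p.1 : Fin (d + 1) → ℝ)) '' (Metric.closedBall 0 1 ×ˢ L)

lemma isCompact_cylinder {d : ℕ} {L : Set (Fin d → ℝ)} (hL : IsCompact L) :
    IsCompact (cylinder L) :=
  ((isCompact_closedBall _ _).prod hL).image (by fun_prop)

lemma collar_eq_zero {d : ℕ} {χ : ℝ → ℝ} {ψ : (Fin d → ℝ) → ℝ} (hχ : ∀ t, 1 < |t| → χ t = 0)
    {x : Fin (d + 1) → ℝ} (hx : x ∉ cylinder (tsupport ψ)) : collar χ ψ x = 0 := by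
  by_contra h
  obtain ⟨h1, h2⟩ := mul_ne_zero_iff.1 h
  refine hx ⟨(x (Fin.last d), Fin.init x), ⟨?_, subset_tsupport _ h2⟩, Fin.snoc_init_self x⟩
  simp only [mem_closedBall_zero_iff, Real.norm_eq_abs]
  exact not_lt.1 fun h' => h1 (hχ _ h')

lemma tendsto_setIntegral_collar {d : ℕ} {χ : ℕ → ℝ → ℝ} {ψ : (Fin d → ℝ) → ℝ}
    {B : (Fin (d + 1) → ℝ) → ℝ} (hB : ContinuousOn B (upperHalf d))
    (hψc : HasCompactSupport ψ) (hψc' : Continuous ψ) (hχc : ∀ n, Continuous (χ n))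
    (hψ1 : ∀ x, |ψ x| ≤ 1)
    (hχ1 : ∀ n t, |χ n t| ≤ 1) (hχ0 : ∀ n t, 1 < |t| → χ n t = 0)
    (hlim : ∀ t ≠ 0, ∀ᶠ n in atTop, χ n t = 0) :
    Tendsto (fun n => ∫ x in upperHalf d, collar (χ n) ψ x ^ 2 * B x) atTop (𝓝 0) := by
  have hH := isClosed_upperHalf d
  have hK : IsCompact (cylinder (tsupport ψ)) := isCompact_cylinder hψc
  set K := cylinder (tsupport ψ)
  have hcc : ∀ n, Continuous (collar (χ n) ψ) := fun n =>
    ((hχc n).comp (continuous_apply _)).mul (hψc'.comp (by unfold Fin.init; fun_prop))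
  have hbound : Integrable (K.indicator fun x => |B x|) (volume.restrict (upperHalf d)) := by
    rw [integrable_indicator_iff hK.measurableSet, IntegrableOn,
      Measure.restrict_restrict hK.measurableSet]
    exact (hB.abs.mono Set.inter_subset_right).integrableOn_compact (hK.inter_right hH)
  have h := tendsto_integral_of_dominated_convergence (μ := volume.restrict (upperHalf d))
    (F := fun n x => collar (χ n) ψ x ^ 2 * B x) (f := fun _ => 0)
    (K.indicator fun x => |B x|)
    (fun n => (((hcc n).pow 2).continuousOn.mul hB).aestronglyMeasurable hH.measurableSet)
    hbound (fun n => .of_forall fun x => ?_) ?_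
  · simpa using h
  · by_cases hx : x ∈ K
    · rw [Set.indicator_of_mem hx, norm_mul, Real.norm_eq_abs, Real.norm_eq_abs, abs_pow]
      refine mul_le_of_le_one_left (abs_nonneg _) (pow_le_one₀ (abs_nonneg _) ?_)
      rw [collar, abs_mul]
      exact mul_le_one₀ (hχ1 _ _) (abs_nonneg _) (hψ1 _)
    · simp [Set.indicator_of_notMem hx, collar_eq_zero (hχ0 n) hx]
  · have h0 : ∀ᵐ x : Fin (d + 1) → ℝ, x (Fin.last d) ≠ 0 := by
      rw [ae_iff]
      simpa [volume_pi] using Measure.pi_hyperplane (fun _ : Fin (d + 1) => (volume : Measure ℝ)) (Fin.last d) 0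
    filter_upwards [ae_restrict_of_ae h0] with x hx
    refine tendsto_const_nhds.congr' ((hlim _ hx).mono fun n hn => ?_)
    simp [collar, hn]

lemma exists_cutoff_seq : ∃ χ : ℕ → ℝ → ℝ, (∀ n, ContDiff ℝ (⊤ : ℕ∞) (χ n)) ∧
    (∀ n, χ n =ᶠ[𝓝 0] 1) ∧ (∀ n t, |χ n t| ≤ 1) ∧ (∀ n t, 1 < |t| → χ n t = 0) ∧
    ∀ t ≠ 0, ∀ᶠ n in atTop, χ n t = 0 := by
  have hpos : ∀ n : ℕ, 0 < 1 / ((n : ℝ) + 1) := fun n => by positivity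
  have hle : ∀ n : ℕ, 1 / ((n : ℝ) + 1) ≤ 1 := fun n =>
    (div_le_one (by positivity)).2 (by linarith [n.cast_nonneg (α := ℝ)])
  let χ : ℕ → ContDiffBump (0 : ℝ) := fun n =>
    ⟨1 / ((n : ℝ) + 1) / 2, 1 / ((n : ℝ) + 1), half_pos (hpos n), half_lt_self (hpos n)⟩
  have hout : ∀ (n : ℕ) (t : ℝ), 1 / ((n : ℝ) + 1) ≤ |t| → χ n t = 0 := fun n t ht =>
    (χ n).zero_of_le_dist (by rwa [Real.dist_0_eq_abs])
  refine ⟨fun n => χ n, fun n => (χ n).contDiff, fun n => (χ n).eventuallyEq_one,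
    fun n t => ?_, fun n t ht => hout n t ((hle n).trans ht.le), fun t ht => ?_⟩
  · rw [abs_of_nonneg (χ n).nonneg]
    exact (χ n).le_one
  · exact (tendsto_one_div_add_atTop_nhds_zero_nat.eventually
      (gt_mem_nhds (abs_pos.2 ht))).mono fun n hn => hout n t hn.le

lemma nonneg_boundary (d : ℕ)
    (q : (Fin (d + 1) → ℝ) → Matrix (Fin (d + 1)) (Fin (d + 1)) ℝ)
    (qb : (Fin d → ℝ) → Matrix (Fin d) (Fin d) ℝ)
    (hqc : ContinuousOn q (upperHalf d)) (hqbc : Continuous qb)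
    (hpos : ∀ f : (Fin (d + 1) → ℝ) → ℝ, ContDiff ℝ (⊤ : ℕ∞) f → HasCompactSupport f →
      (∀ xb : Fin d → ℝ, pd (Fin.last d) f (Fin.snoc xb 0) = 0) →
      0 ≤ (∫ x in upperHalf d, ∑ i, ∑ j, q x i j * pd i f x * pd j f x)
          + ∫ xb : Fin d → ℝ, ∑ i, ∑ j,
              qb xb i j * pd (Fin.castSucc i) f (Fin.snoc xb 0)
                * pd (Fin.castSucc j) f (Fin.snoc xb 0))
    (x₀ v : Fin d → ℝ) : 0 ≤ ∑ i, ∑ j, qb x₀ i j * v i * v j := by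
  by_contra! hneg
  have hB : Continuous fun x => ∑ i, ∑ j, qb x i j * v i * v j :=
    continuousOn_univ.1
      (continuousOn_sum_sum_mul hqbc.continuousOn (g := fun i _ => v i) fun _ => continuous_const)
  set B := fun x => ∑ i, ∑ j, qb x i j * v i * v j
  have hBn : B x₀ < 0 := hneg
  obtain ⟨r, hr, hball⟩ := Metric.nhds_basis_closedBall.eventually_iff.1
    (hB.continuousAt.eventually (gt_mem_nhds (show B x₀ < B x₀ / 2 by linarith)))
  let ψ : ContDiffBump x₀ := ⟨r / 2, r, by linarith, by linarith⟩
  have hsub : ∀ x, ψ x ≠ 0 → x ∈ Set.univ ∧ B x ≤ B x₀ / 2 := fun x hx => by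
    have h : x ∈ tsupport ψ := subset_tsupport _ hx
    rw [ψ.tsupport_eq] at h
    exact ⟨Set.mem_univ _, (hball h).le⟩
  have hψ2 : HasCompactSupport fun x => ψ x ^ 2 :=
    ψ.hasCompactSupport.comp_left (g := fun y : ℝ => y ^ 2) (by simp)
  have hint : Integrable fun x => ψ x ^ 2 * B x :=
    ((ψ.continuous.pow 2).mul hB).integrable_of_hasCompactSupport hψ2.mul_right
  have hlt := setIntegral_sq_mul_neg (μ := volume) MeasurableSet.univ
    (show B x₀ / 2 < 0 by linarith) ψ.continuous ψ.hasCompactSupport (x₀ := x₀)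
    (by simp [ψ.one_of_mem_closedBall (Metric.mem_closedBall_self ψ.rIn_pos.le)]) hsub
    hint.integrableOn
  rw [setIntegral_univ] at hlt
  obtain ⟨χ, hχs, hχ1, hχle, hχ0, hχlim⟩ := exists_cutoff_seq
  set w : Fin (d + 1) → ℝ := Fin.snoc v 0
  have hψs : ContDiff ℝ (⊤ : ℕ∞) ψ := ψ.contDiff
  have hlim := tendsto_setIntegral_collar (χ := χ) (ψ := ψ)
    (continuousOn_sum_sum_mul hqc (g := fun i _ => w i) fun _ => continuous_const)
    ψ.hasCompactSupport ψ.continuous (fun n => (hχs n).continuous)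
    (fun x => by rw [abs_of_nonneg ψ.nonneg]; exact ψ.le_one) hχle hχ0 hχlim
  have key : ∀ n, 0 ≤ (∫ x in upperHalf d, collar (χ n) ψ x ^ 2 * ∑ i, ∑ j, q x i j * w i * w j)
      + ∫ x, ψ x ^ 2 * B x := fun n => by
    have h := nonneg_of_oscillating_test d q qb hqc hqbc hpos (contDiff_collar (hχs n) hψs)
      (.intro (isCompact_cylinder ψ.hasCompactSupport) fun x hx => collar_eq_zero (hχ0 n) hx) w
      (pd_last_collar (hχs n) hψs (hχ1 n)) (fun xb => by simp [w])
    have hb : ∀ xb : Fin d → ℝ, collar (χ n) ψ (Fin.snoc xb 0) = ψ xb := fun xb => by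
      simp [collar, (hχ1 n).self_of_nhds]
    have hwc : ∀ i : Fin d, w i.castSucc = v i := fun i => by simp [w]
    simp only [hb, hwc, sum_sum_mul_scale] at h
    exact h
  have := ge_of_tendsto' (hlim.add_const (∫ x, ψ x ^ 2 * B x)) key
  linarith

/-- half-space case of Lemma 2.3(1): if `q` is a continuous field of
symmetric matrices on `H` and `q_∂` a continuous field of symmetric matrices on the
boundary `ℝ^{d-1}`, and
`∫_H ⟨q ∇f, ∇f⟩ dx + ∫_{∂H} ⟨q_∂ ∇̂f, ∇̂f⟩ dxb ≥ 0` for every `f ∈ C_c^∞(ℝ^d)`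
satisfying the Neumann condition `∂_d f(·,0) = 0`, then `q` is positive semidefinite
on `H` and `q_∂` is positive semidefinite everywhere.
(Ambient dimension is `d + 1` with `d ≥ 1`, i.e. dimension `≥ 2`.) -/
theorem half_space_matrix_fields_nonneg_neumann
    (d : ℕ) (hd : 1 ≤ d)
    (q : (Fin (d + 1) → ℝ) → Matrix (Fin (d + 1)) (Fin (d + 1)) ℝ)
    (qb : (Fin d → ℝ) → Matrix (Fin d) (Fin d) ℝ)
    (hqc : ContinuousOn q (upperHalf d)) (hqbc : Continuous qb)
    (hqs : ∀ x ∈ upperHalf d, (q x).IsSymm) (hqbs : ∀ xb, (qb xb).IsSymm)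
    (hpos : ∀ f : (Fin (d + 1) → ℝ) → ℝ, ContDiff ℝ (⊤ : ℕ∞) f → HasCompactSupport f →
      (∀ xb : Fin d → ℝ, pd (Fin.last d) f (Fin.snoc xb 0) = 0) →
      0 ≤ (∫ x in upperHalf d, ∑ i, ∑ j, q x i j * pd i f x * pd j f x)
          + ∫ xb : Fin d → ℝ, ∑ i, ∑ j,
              qb xb i j * pd (Fin.castSucc i) f (Fin.snoc xb 0)
                * pd (Fin.castSucc j) f (Fin.snoc xb 0)) :
    (∀ x ∈ upperHalf d, (q x).PosSemidef) ∧ (∀ xb, (qb xb).PosSemidef) := by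
  exact ⟨fun x hx => posSemidef_of_sum_sum_nonneg (hqs x hx) fun v =>
      nonneg_of_mem_upperHalf hqc v
        (fun _ hy => nonneg_of_pos_last d q qb hqc hqbc hpos hy v) hx,
    fun xb => posSemidef_of_sum_sum_nonneg (hqbs xb) fun v =>
      nonneg_boundary d q qb hqc hqbc hpos xb v⟩
end
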